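/- arXiv:2001.08628 — 2 statements merged into one kernel-verified Lean document; each statement's English description precedes it below -/
import Mathlib

section
/- For every real α ∈ (0, 1) and every real ε > 0 there is an integer n₀ such that for every integer n ≥ n₀, (1 − α − ε) · n^α ≤ ldim(Q(n; 1, n − ⌊n^α⌋)) ≤ ⌊n^α⌋ + 2. In particular ldim(Q(n; 1, n − ⌊n^α⌋)) = Θ(n^α). -/
open scoped Classical

namespace PaperLD

/-- A partial linear extension of a poset `α`: a duplicate-free list whose
listing order extends the partial order on the elements it contains. -/
structure PLE (α : Type*) [PartialOrder α] where
  toList : List α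
  nodup : toList.Nodup
  le_imp : ∀ i j : Fin toList.length, toList.get i ≤ toList.get j → i ≤ j

/-- `x` occurs (weakly) before `y` in the partial linear extension `L`
(in particular both `x` and `y` belong to the ground set of `L`). -/
def PLE.Before {α : Type*} [PartialOrder α] (L : PLE α) (x y : α) : Prop :=
  ∃ i j : Fin L.toList.length, i ≤ j ∧ L.toList.get i = x ∧ L.toList.get j = y

/-- A family of partial linear extensions is a local realiser if, for every
ordered pair `(x, y)` with `x ≱ y`, some member lists `x` before `y`. -/
def IsLocalRealiser {α : Type*} [PartialOrder α] {ι : Type*} (F : ι → PLE α) : Prop :=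
  ∀ x y : α, ¬ y ≤ x → ∃ i, (F i).Before x y

/-- The multiplicity of `x` in a finite family of partial linear extensions:
the number of members whose ground set contains `x`. -/
noncomputable def mult {α : Type*} [PartialOrder α] {N : ℕ} (F : Fin N → PLE α) (x : α) : ℕ :=
  (Finset.univ.filter fun i => x ∈ (F i).toList).card

/-- The local dimension of a finite poset: the least `d` such that there is a
local realiser in which every element has multiplicity at most `d`. -/
noncomputable def ldim (α : Type*) [PartialOrder α] [Fintype α] : ℕ :=
  sInf {d | ∃ (N : ℕ) (F : Fin N → PLE α), IsLocalRealiser F ∧ ∀ x : α, mult F x ≤ d}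

/-- The order dimension of a finite poset: the least `d` such that some family of `d`
linear extensions (partial linear extensions containing every element) is a realiser. -/
noncomputable def odim (α : Type*) [PartialOrder α] [Fintype α] : ℕ :=
  sInf {d | ∃ F : Fin d → PLE α, (∀ i, ∀ x : α, x ∈ (F i).toList) ∧ IsLocalRealiser F}

/-- `BoolLayers n ℓ k` is the suborder of the Boolean lattice `Q(n)` induced by the
`ℓ`-th and `k`-th layers: all subsets of an `n`-set of cardinality `ℓ` or `k`,
ordered by inclusion. -/
abbrev BoolLayers (n ℓ k : ℕ) := {s : Finset (Fin n) // s.card = ℓ ∨ s.card = k}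

end PaperLD

open PaperLD

namespace PaperLD

/-- The elements of a finite set, listed by increasing value of an injective monotone key. -/
theorem PLE.exists_of_key {α : Type*} [PartialOrder α] (s : Finset α) (f : α → ℤ)
    (hf : Function.Injective f) (hmono : ∀ x ∈ s, ∀ y ∈ s, x ≤ y → f x ≤ f y) :
    ∃ L : PLE α, (∀ x, x ∈ L.toList ↔ x ∈ s) ∧
      ∀ x ∈ s, ∀ y ∈ s, f x ≤ f y → L.Before x y := by
  let r : α → α → Prop := fun x y => f x ≤ f y
  have : IsTrans α r := ⟨fun _ _ _ h h' => le_trans h h'⟩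
  have : Std.Antisymm r := ⟨fun _ _ h h' => hf (le_antisymm h h')⟩
  have : Std.Total r := ⟨fun x y => le_total (f x) (f y)⟩
  have hs : (s.sort r).Pairwise r := Finset.pairwise_sort s r
  have hnd : (s.sort r).Nodup := Finset.sort_nodup s r
  have hmem : ∀ x, x ∈ s.sort r ↔ x ∈ s := fun x => Finset.mem_sort r
  have hidx : ∀ i j : Fin (s.sort r).length,
      f ((s.sort r).get i) ≤ f ((s.sort r).get j) → i ≤ j := by
    intro i j hij
    by_contra! hlt
    have h := List.pairwise_iff_get.1 hs j i hlt
    have heq : (s.sort r).get i = (s.sort r).get j := hf (le_antisymm hij h)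
    exact hlt.ne' (List.nodup_iff_injective_get.1 hnd heq)
  refine ⟨⟨s.sort r, hnd, fun i j hij => hidx i j (hmono _ ?_ _ ?_ hij)⟩, hmem, ?_⟩
  · exact (hmem _).1 (List.get_mem _ _)
  · exact (hmem _).1 (List.get_mem _ _)
  · intro x hx y hy hxy
    obtain ⟨i, hi⟩ := List.get_of_mem ((hmem x).2 hx)
    obtain ⟨j, hj⟩ := List.get_of_mem ((hmem y).2 hy)
    exact ⟨i, j, hidx i j (by rwa [hi, hj]), hi, hj⟩

theorem PLE.Before.left_mem {α : Type*} [PartialOrder α] {L : PLE α} {x y : α}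
    (h : L.Before x y) : x ∈ L.toList := by
  obtain ⟨i, j, -, rfl, -⟩ := h
  exact List.get_mem _ _

theorem PLE.Before.right_mem {α : Type*} [PartialOrder α] {L : PLE α} {x y : α}
    (h : L.Before x y) : y ∈ L.toList := by
  obtain ⟨i, j, -, -, rfl⟩ := h
  exact List.get_mem _ _

theorem PLE.before_iff {α : Type*} [PartialOrder α] {L : PLE α} {x y : α} :
    L.Before x y ↔
      x ∈ L.toList ∧ y ∈ L.toList ∧ L.toList.idxOf x ≤ L.toList.idxOf y := by
  constructor
  · intro h
    refine ⟨h.left_mem, h.right_mem, ?_⟩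
    obtain ⟨i, j, hij, rfl, rfl⟩ := h
    simp only [List.get_eq_getElem]
    rw [L.nodup.idxOf_getElem, L.nodup.idxOf_getElem]
    exact hij
  · rintro ⟨hx, hy, hxy⟩
    exact ⟨⟨_, List.idxOf_lt_length_of_mem hx⟩, ⟨_, List.idxOf_lt_length_of_mem hy⟩, hxy,
      by simp, by simp⟩

theorem PLE.Before.trans {α : Type*} [PartialOrder α] {L : PLE α} {x y z : α}
    (h : L.Before x y) (h' : L.Before y z) : L.Before x z := by
  rw [PLE.before_iff] at *
  exact ⟨h.1, h'.2.1, h.2.2.trans h'.2.2⟩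

theorem PLE.Before.antisymm {α : Type*} [PartialOrder α] {L : PLE α} {x y : α}
    (h : L.Before x y) (h' : L.Before y x) : x = y := by
  rw [PLE.before_iff] at *
  exact (List.idxOf_inj h.1).1 (le_antisymm h.2.2 h'.2.2)

theorem PLE.before_of_le {α : Type*} [PartialOrder α] {L : PLE α} {x y : α}
    (hx : x ∈ L.toList) (hy : y ∈ L.toList) (hxy : x ≤ y) : L.Before x y := by
  obtain ⟨i, rfl⟩ := List.get_of_mem hx
  obtain ⟨j, rfl⟩ := List.get_of_mem hy
  exact ⟨i, j, L.le_imp i j hxy, rfl, rfl⟩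

theorem PLE.exists_first {α ι : Type*} [PartialOrder α] (L : PLE α) (f : ι → α)
    (s : Finset ι) (hs : s.Nonempty) (hL : ∀ i ∈ s, f i ∈ L.toList) :
    ∃ i ∈ s, ∀ j ∈ s, L.Before (f i) (f j) := by
  obtain ⟨i, hi, hmin⟩ := Finset.exists_min_image s (fun i => L.toList.idxOf (f i)) hs
  exact ⟨i, hi, fun j hj => PLE.before_iff.2 ⟨hL i hi, hL j hj, hmin j hj⟩⟩

/-- A local realiser indexed by an arbitrary finite type can be indexed by some `Fin N`. -/
theorem exists_fin_realiser {α : Type*} [PartialOrder α] {ι : Type*} [Fintype ι]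
    (F : ι → PLE α) (hF : IsLocalRealiser F) (d : ℕ)
    (hd : ∀ x, ∃ T : Finset ι, T.card ≤ d ∧ ∀ i, x ∈ (F i).toList → i ∈ T) :
    ∃ (N : ℕ) (G : Fin N → PLE α), IsLocalRealiser G ∧ ∀ x : α, mult G x ≤ d := by
  let e := (Fintype.equivFin ι).symm
  refine ⟨Fintype.card ι, fun i => F (e i), ?_, ?_⟩
  · intro x y h
    obtain ⟨i, hi⟩ := hF x y h
    exact ⟨e.symm i, by simpa using hi⟩
  · intro x
    obtain ⟨T, hT, hxT⟩ := hd x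
    refine le_trans ?_ hT
    unfold mult
    refine Finset.card_le_card_of_injOn e ?_ e.injective.injOn
    intro i hi
    exact hxT _ (Finset.mem_filter.1 hi).2

theorem BoolLayers.eq_or_of_le {n m : ℕ} (hm : 2 ≤ m) {x y : BoolLayers n 1 m} (h : x ≤ y) :
    x = y ∨ (x.1.card = 1 ∧ y.1.card ≠ 1) := by
  have hsub : x.1 ⊆ y.1 := h
  have hc := Finset.card_le_card hsub
  rcases x.2 with hx | hx <;> rcases y.2 with hy | hy
  · exact Or.inl (Subtype.ext (Finset.eq_of_subset_of_card_le hsub (by omega)))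
  · exact Or.inr ⟨hx, by omega⟩
  · omega
  · exact Or.inl (Subtype.ext (Finset.eq_of_subset_of_card_le hsub (by omega)))

/-- The upper bound: two linear extensions together with, for each `i`, the partial linear
extension placing the sets that avoid `i` before `{i}`. -/
theorem BoolLayers.exists_realiser {n m : ℕ} (hm : 2 ≤ m) (hmn : m < n) :
    ∃ (N : ℕ) (F : Fin N → PLE (BoolLayers n 1 m)), IsLocalRealiser F ∧
      ∀ x, mult F x ≤ n - m + 2 := by
  let X := BoolLayers n 1 m
  let e : X → ℤ := fun x => (Fintype.equivFin X x : ℕ)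
  let N : ℤ := Fintype.card X
  have he : Function.Injective e := fun x y h =>
    (Fintype.equivFin X).injective (Fin.ext (by simpa [e] using h))
  have he0 : ∀ x, 0 ≤ e x := fun x => by simp [e]
  have heN : ∀ x, e x < N := fun x => by simp only [e, N]; exact_mod_cast (Fintype.equivFin X x).2
  have main : ∀ (s : Finset X) (f : X → ℤ), Function.Injective f →
      (∀ x ∈ s, ∀ y ∈ s, x ≤ y → x.1.card = 1 → y.1.card ≠ 1 → f x ≤ f y) →
      ∃ L : PLE X, (∀ x, x ∈ L.toList ↔ x ∈ s) ∧
        ∀ x ∈ s, ∀ y ∈ s, f x ≤ f y → L.Before x y := by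
    intro s f hf h
    refine PLE.exists_of_key s f hf fun x hx y hy hxy => ?_
    rcases BoolLayers.eq_or_of_le hm hxy with rfl | ⟨h1, h2⟩
    · exact le_rfl
    · exact h x hx y hy hxy h1 h2
  obtain ⟨A, hA, hA'⟩ := main Finset.univ (fun x => if x.1.card = 1 then e x else N + e x)
    (by
      intro x y hxy
      have := he0 x; have := he0 y; have := heN x; have := heN y
      apply he
      simp only at hxy
      split_ifs at hxy <;> omega)
    (by
      intro x _ y _ _ h1 h2
      have := he0 y; have := heN x
      simp only [h1, h2, if_true, if_false]
      omega)
  obtain ⟨B, hB, hB'⟩ := main Finset.univ (fun x => if x.1.card = 1 then - e x else N - e x)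
    (by
      intro x y hxy
      have := he0 x; have := he0 y; have := heN x; have := heN y
      apply he
      simp only at hxy
      split_ifs at hxy <;> omega)
    (by
      intro x _ y _ _ h1 h2
      have := he0 x; have := heN y
      simp only [h1, h2, if_true, if_false]
      omega)
  have hC : ∀ i : Fin n, ∃ L : PLE X,
      (∀ x, x ∈ L.toList ↔ x.1 = {i} ∨ (x.1.card ≠ 1 ∧ i ∉ x.1)) ∧
        ∀ x y : X, y.1 = {i} → x.1.card ≠ 1 → i ∉ x.1 → L.Before x y := by
    intro i
    obtain ⟨L, hL, hL'⟩ := main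
      (Finset.univ.filter fun x => x.1 = {i} ∨ (x.1.card ≠ 1 ∧ i ∉ x.1))
      (fun x => if x.1.card = 1 then N + e x else e x)
      (by
        intro x y hxy
        have := he0 x; have := he0 y; have := heN x; have := heN y
        apply he
        simp only at hxy
        split_ifs at hxy <;> omega)
      (by
        intro x hx y hy hxy h1 h2
        exfalso
        have hxi : x.1 = {i} := by
          rcases (Finset.mem_filter.1 hx).2 with h | h
          · exact h
          · exact absurd h1 h.1
        rcases (Finset.mem_filter.1 hy).2 with h | h
        · exact h2 (by simp [h])
        · have hsub : x.1 ⊆ y.1 := hxy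
          exact h.2 (hsub (by simp [hxi])))
    refine ⟨L, fun x => by simp [hL], fun x y hy hx hxi => hL' x ?_ y ?_ ?_⟩
    · exact Finset.mem_filter.2 ⟨Finset.mem_univ _, Or.inr ⟨hx, hxi⟩⟩
    · exact Finset.mem_filter.2 ⟨Finset.mem_univ _, Or.inl hy⟩
    · have h1 : y.1.card = 1 := by simp [hy]
      have := he0 y; have := heN x
      simp only [h1, hx, if_true, if_false]
      omega
  choose C hCmem hCbef using hC
  refine exists_fin_realiser (Sum.elim (fun b : Bool => if b then A else B) C) ?_ _ ?_
  · intro x y hxy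
    have hx0 := he0 x; have hy0 := he0 y; have hxN := heN x; have hyN := heN y
    by_cases hx : x.1.card = 1
    · by_cases hle : e x ≤ e y ∨ y.1.card ≠ 1
      · refine ⟨Sum.inl true, hA' x (Finset.mem_univ _) y (Finset.mem_univ _) ?_⟩
        simp only [hx, if_true]
        split_ifs <;> omega
      · refine ⟨Sum.inl false, hB' x (Finset.mem_univ _) y (Finset.mem_univ _) ?_⟩
        simp only [hx, if_true]
        split_ifs <;> omega
    · by_cases hy : y.1.card = 1
      · obtain ⟨i, hi⟩ := Finset.card_eq_one.1 hy
        refine ⟨Sum.inr i, hCbef i x y hi hx fun hix => hxy ?_⟩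
        change y.1 ⊆ x.1
        simpa [hi] using hix
      · by_cases hle : e x ≤ e y
        · refine ⟨Sum.inl true, hA' x (Finset.mem_univ _) y (Finset.mem_univ _) ?_⟩
          simp only [hx, hy, if_false]
          omega
        · refine ⟨Sum.inl false, hB' x (Finset.mem_univ _) y (Finset.mem_univ _) ?_⟩
          simp only [hx, hy, if_false]
          omega
  · intro x
    let T : Finset (Fin n) := if x.1.card = 1 then x.1 else x.1ᶜ
    have hT : T.card ≤ n - m := by
      rcases x.2 with h | h
      · simp only [T, h, if_true]; omega
      · have h1 : x.1.card ≠ 1 := by omega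
        simp only [T, h1, if_false, Finset.card_compl, Fintype.card_fin]; omega
    refine ⟨Finset.univ.disjSum T, ?_, ?_⟩
    · rw [Finset.card_disjSum, Finset.card_univ, Fintype.card_bool]
      omega
    · rintro (b | i) hi
      · simp
      · rw [Finset.inr_mem_disjSum]
        rcases (hCmem i x).1 hi with h | h
        · simp [T, h]
        · simp [T, h]

/-- Finite subsets of size at most `d` of a set of size at most `n * d`. -/
theorem card_subsets_le {β : Type*} (P : Finset β) (n d : ℕ) (hn : 0 < n)
    (hP : P.card ≤ n * d) :
    ((P.powerset.filter fun A => A.card ≤ d).card : ℝ) ≤ (Real.exp 1 * n) ^ d := by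
  have hn' : (0 : ℝ) < n := by exact_mod_cast hn
  have hn1 : (1 : ℝ) ≤ n := by exact_mod_cast hn
  have hsum : ∑ A ∈ P.powerset, ((1 : ℝ) / n) ^ A.card = (1 / n + 1) ^ P.card := by
    have := Finset.sum_pow_mul_eq_add_pow ((1 : ℝ) / n) 1 P
    simpa using this
  have h1 : ((P.powerset.filter fun A => A.card ≤ d).card : ℝ)
      ≤ ∑ A ∈ P.powerset, (n : ℝ) ^ d * ((1 : ℝ) / n) ^ A.card := by
    rw [Finset.card_eq_sum_ones, Nat.cast_sum]
    refine (Finset.sum_le_sum fun A hA => ?_).trans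
      (Finset.sum_le_sum_of_subset_of_nonneg (Finset.filter_subset _ _) fun A _ _ => by positivity)
    have hA' := (Finset.mem_filter.1 hA).2
    rw [one_div, inv_pow, ← div_eq_mul_inv, Nat.cast_one, le_div_iff₀ (by positivity), one_mul]
    exact pow_le_pow_right₀ hn1 hA'
  refine h1.trans ?_
  rw [← Finset.mul_sum, hsum, mul_pow, mul_comm]
  refine mul_le_mul_of_nonneg_right ?_ (by positivity)
  calc (1 / (n : ℝ) + 1) ^ P.card ≤ (1 / (n : ℝ) + 1) ^ (n * d) :=
        pow_le_pow_right₀ (by linarith [show (0 : ℝ) < 1 / n by positivity]) hP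
    _ ≤ (Real.exp (1 / n)) ^ (n * d) :=
        pow_le_pow_left₀ (by positivity) (Real.add_one_le_exp _) _
    _ = Real.exp 1 ^ d := by
        rw [pow_mul, ← Real.exp_nat_mul]
        congr 2
        field_simp

/-- In a local realiser every set in the upper layer is determined by the elements `{i}` that
come first after it in the members containing it. -/
theorem BoolLayers.choose_le {n m d N : ℕ} (hm : 2 ≤ m) (hn : 0 < n)
    (F : Fin N → PLE (BoolLayers n 1 m)) (hF : IsLocalRealiser F) (hd : ∀ x, mult F x ≤ d) :
    (n.choose m : ℝ) ≤ (Real.exp 1 * n) ^ d := by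
  let sing : Fin n → BoolLayers n 1 m := fun i => ⟨{i}, Or.inl (Finset.card_singleton i)⟩
  have hsing : Function.Injective sing := fun i j h => by simpa [sing] using h
  let P : Finset (Fin n × Fin N) := Finset.univ.filter fun p => sing p.1 ∈ (F p.2).toList
  have hP : P.card ≤ n * d := by
    have h := Finset.card_le_mul_card_image_of_maps_to (f := Prod.fst) (s := P)
      (t := Finset.univ) (fun _ _ => Finset.mem_univ _) d (by
        intro i _
        refine le_trans ?_ (hd (sing i))
        unfold mult
        refine Finset.card_le_card_of_injOn Prod.snd ?_ ?_
        · intro p hp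
          simp only [P, Finset.coe_filter, Finset.mem_filter, Finset.mem_univ, true_and,
            Set.mem_ofPred_eq] at hp ⊢
          rw [← hp.2]; exact hp.1
        · intro p hp q hq hpq
          simp only [Finset.coe_filter, Set.mem_ofPred_eq] at hp hq
          exact Prod.ext (hp.2.trans hq.2.symm) hpq)
    simpa [mul_comm] using h
  let U := Finset.univ.filter fun x : BoolLayers n 1 m => x.1.card = m
  have hU : U.card = n.choose m := by
    have hc : n.choose m = (Finset.powersetCard m (Finset.univ : Finset (Fin n))).card := by simp
    rw [hc]
    refine Finset.card_bij (fun x _ => x.1) ?_ ?_ ?_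
    · intro x hx; simpa [U, Finset.mem_powersetCard] using hx
    · intro x _ y _ h; exact Subtype.ext h
    · intro s hs
      have hs' := (Finset.mem_powersetCard.1 hs).2
      exact ⟨⟨s, Or.inr hs'⟩, by simp [U, hs'], rfl⟩
  let A : BoolLayers n 1 m → Finset (Fin n × Fin N) := fun x => P.filter fun p =>
    (F p.2).Before x (sing p.1) ∧
      ∀ j, (F p.2).Before x (sing j) → (F p.2).Before (sing p.1) (sing j)
  have hAcard : ∀ x, (A x).card ≤ d := by
    intro x
    refine le_trans ?_ (hd x)
    unfold mult
    refine Finset.card_le_card_of_injOn Prod.snd ?_ ?_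
    · intro p hp
      simp only [A, Finset.coe_filter, Finset.mem_univ, true_and,
        Set.mem_ofPred_eq] at hp ⊢
      exact hp.2.1.left_mem
    · rintro ⟨i, l⟩ hp ⟨j, l'⟩ hq (rfl : l = l')
      simp only [A, Finset.coe_filter, Set.mem_ofPred_eq] at hp hq
      have := hsing ((hp.2.2 j hq.2.1).antisymm (hq.2.2 i hp.2.1))
      rw [this]
  have hrec : ∀ x ∈ U, ∀ i, i ∉ x.1 ↔ ∃ p ∈ A x, (F p.2).Before (sing p.1) (sing i) := by
    intro x hx i
    have hxm : x.1.card = m := (Finset.mem_filter.1 hx).2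
    constructor
    · intro hi
      obtain ⟨l, hl⟩ := hF x (sing i) fun h => hi (by
        have hsub : ({i} : Finset (Fin n)) ⊆ x.1 := h
        simpa using hsub)
      obtain ⟨j, hj, hmin⟩ := (F l).exists_first sing
        (Finset.univ.filter fun j => (F l).Before x (sing j)) ⟨i, by simpa using hl⟩
        fun j hj => (Finset.mem_filter.1 hj).2.right_mem
      have hj' : (F l).Before x (sing j) := (Finset.mem_filter.1 hj).2
      have hfirst : ∀ j', (F l).Before x (sing j') → (F l).Before (sing j) (sing j') :=
        fun j' h => hmin j' (by simpa using h)
      exact ⟨(j, l), by simpa [A, P] using ⟨hj'.right_mem, hj', hfirst⟩, hfirst i hl⟩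
    · rintro ⟨p, hp, hpi⟩ hi
      have hb := (Finset.mem_filter.1 hp).2.1.trans hpi
      have hle : sing i ≤ x := by
        change ({i} : Finset (Fin n)) ⊆ x.1
        simpa using hi
      have heq := hb.antisymm (PLE.before_of_le hb.right_mem hb.left_mem hle)
      rw [heq] at hxm
      simp [sing] at hxm
      omega
  have hcard : U.card ≤ (P.powerset.filter fun B => B.card ≤ d).card := by
    refine Finset.card_le_card_of_injOn A ?_ ?_
    · intro x _
      simp only [Finset.coe_filter, Finset.mem_powerset, Set.mem_ofPred_eq]
      exact ⟨Finset.filter_subset _ _, hAcard x⟩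
    · intro x hx y hy hxy
      refine Subtype.ext (Finset.ext fun i => not_iff_not.1 ?_)
      rw [hrec x hx, hrec y hy, hxy]
  rw [← hU]
  exact (Nat.cast_le.2 hcard).trans (card_subsets_le P n d hn hP)

theorem ldim_spec {α : Type*} [PartialOrder α] [Fintype α] {d : ℕ}
    (h : ∃ (N : ℕ) (F : Fin N → PLE α), IsLocalRealiser F ∧ ∀ x : α, mult F x ≤ d) :
    (∃ (N : ℕ) (F : Fin N → PLE α), IsLocalRealiser F ∧ ∀ x : α, mult F x ≤ ldim α) ∧
      ldim α ≤ d :=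
  ⟨Nat.sInf_mem (s := {d | ∃ (N : ℕ) (F : Fin N → PLE α),
    IsLocalRealiser F ∧ ∀ x : α, mult F x ≤ d}) ⟨d, h⟩, Nat.sInf_le h⟩

theorem div_pow_le_choose {n k : ℕ} (hk : 0 < k) (hkn : 2 * k ≤ n) :
    ((n : ℝ) / (2 * k)) ^ k ≤ n.choose k := by
  have hk' : (0 : ℝ) < k := by exact_mod_cast hk
  have h1 : ((n + 1 - k : ℕ) : ℝ) ^ k ≤ (k.factorial : ℝ) * n.choose k := by
    have := Nat.pow_sub_le_descFactorial n k
    rw [Nat.descFactorial_eq_factorial_mul_choose] at this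
    exact_mod_cast this
  have h2 : (k.factorial : ℝ) ≤ (k : ℝ) ^ k := by exact_mod_cast Nat.factorial_le_pow k
  have h3 : ((n : ℝ) / 2) ^ k ≤ ((n + 1 - k : ℕ) : ℝ) ^ k := by
    refine pow_le_pow_left₀ (by positivity) ?_ _
    rw [div_le_iff₀ (by norm_num)]
    have : n ≤ (n + 1 - k) * 2 := by omega
    exact_mod_cast this
  rw [← div_div, div_pow, div_le_iff₀ (by positivity), mul_comm]
  exact h3.trans (h1.trans (mul_le_mul_of_nonneg_right h2 (by positivity)))

theorem eventually_asymptotic_bound (α ε : ℝ) (h0 : 0 < α) (hε : 0 < ε) :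
    ∀ᶠ x : ℝ in Filter.atTop, (1 - α - ε) * x ^ α * (1 + Real.log x) ≤
      (x ^ α - 1) * ((1 - α) * Real.log x - Real.log 2) := by
  have hx := tendsto_rpow_atTop h0
  have hl := Real.tendsto_log_atTop
  have h1 : Filter.Tendsto (fun x : ℝ => (x ^ α)⁻¹) Filter.atTop (nhds 0) :=
    hx.inv_tendsto_atTop
  have h2 : Filter.Tendsto (fun x : ℝ => (Real.log x)⁻¹) Filter.atTop (nhds 0) :=
    hl.inv_tendsto_atTop
  have h3 : Filter.Tendsto (fun x : ℝ => (1 - (x ^ α)⁻¹) * ((1 - α) - Real.log 2 * (Real.log x)⁻¹)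
      - (1 - α - ε) * ((Real.log x)⁻¹ + 1)) Filter.atTop
      (nhds ((1 - 0) * ((1 - α) - Real.log 2 * 0) - (1 - α - ε) * (0 + 1))) :=
    ((h1.const_sub 1).mul ((h2.const_mul _).const_sub _)).sub ((h2.add_const 1).const_mul _)
  have h4 := h3.eventually (lt_mem_nhds (a := 0) (by linarith))
  filter_upwards [h4, hx.eventually_gt_atTop 0, hl.eventually_gt_atTop 0] with x hx4 hxa hxl
  have h5 := mul_pos (mul_pos hxa hxl) hx4
  have h6 : x ^ α * Real.log x * ((1 - (x ^ α)⁻¹) * ((1 - α) - Real.log 2 * (Real.log x)⁻¹)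
      - (1 - α - ε) * ((Real.log x)⁻¹ + 1)) =
      (x ^ α - 1) * ((1 - α) * Real.log x - Real.log 2)
        - (1 - α - ε) * x ^ α * (1 + Real.log x) := by
    field_simp
  linarith

end PaperLD

/-- For every `α ∈ (0, 1)` and `ε > 0` there is `n₀` such that for all `n ≥ n₀`,
`(1 − α − ε)·n^α ≤ ldim(Q(n; 1, n − ⌊n^α⌋)) ≤ ⌊n^α⌋ + 2`; in particular this local
dimension is `Θ(n^α)`. -/
theorem stmt15 (α ε : ℝ) (h0 : 0 < α) (h1 : α < 1) (hε : 0 < ε) :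
    ∃ n₀ : ℕ, ∀ n : ℕ, n₀ ≤ n →
      (1 - α - ε) * (n : ℝ) ^ α ≤ (ldim (BoolLayers n 1 (n - ⌊(n : ℝ) ^ α⌋₊)) : ℝ) ∧
      ldim (BoolLayers n 1 (n - ⌊(n : ℝ) ^ α⌋₊)) ≤ ⌊(n : ℝ) ^ α⌋₊ + 2 := by
  have hlarge : ∀ᶠ x : ℝ in Filter.atTop, 2 * x ^ α ≤ x := by
    filter_upwards [(tendsto_rpow_atTop (sub_pos.2 h1)).eventually_ge_atTop 2,
      Filter.eventually_gt_atTop 0] with x hx hx0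
    calc 2 * x ^ α ≤ x ^ (1 - α) * x ^ α := by gcongr
      _ = x := by rw [← Real.rpow_add hx0]; simp
  have hpos : ∀ᶠ x : ℝ in Filter.atTop,
      0 ≤ (1 - α) * Real.log x - Real.log 2 := by
    filter_upwards [(Real.tendsto_log_atTop.const_mul_atTop
      (sub_pos.2 h1)).eventually_ge_atTop (Real.log 2)] with x hx
    linarith
  have hev := tendsto_natCast_atTop_atTop.eventually
    (hlarge.and (hpos.and ((eventually_asymptotic_bound α ε h0 hε).and
      (Filter.eventually_ge_atTop (4 : ℝ)))))
  obtain ⟨n₀, hn₀⟩ := Filter.eventually_atTop.1 hev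
  refine ⟨n₀, fun n hn => ?_⟩
  obtain ⟨hlarge, hpos, hbound, h4⟩ := hn₀ n hn
  have hn4 : 4 ≤ n := by exact_mod_cast h4
  have hn0 : (0 : ℝ) < n := by linarith
  have hna : (1 : ℝ) ≤ (n : ℝ) ^ α := Real.one_le_rpow (by linarith) h0.le
  set k := ⌊(n : ℝ) ^ α⌋₊ with hk
  have hk1 : 0 < k := Nat.floor_pos.2 hna
  have hkle : (k : ℝ) ≤ (n : ℝ) ^ α := Nat.floor_le (by linarith)
  have hkge : (n : ℝ) ^ α - 1 ≤ k := (Nat.sub_one_lt_floor _).le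
  have hkn : 2 * k ≤ n := by
    have : 2 * (k : ℝ) ≤ n := by linarith
    exact_mod_cast this
  have hk0 : (0 : ℝ) < k := by exact_mod_cast hk1
  have hup := BoolLayers.exists_realiser (n := n) (m := n - k) (by omega) (by omega)
  rw [Nat.sub_sub_self (by omega : k ≤ n)] at hup
  obtain ⟨⟨N, F, hF, hd⟩, hle⟩ := ldim_spec hup
  refine ⟨?_, hle⟩
  set d := ldim (BoolLayers n 1 (n - k)) with hddef
  have hch := BoolLayers.choose_le (by omega) (by omega) F hF hd
  rw [Nat.choose_symm (by omega : k ≤ n)] at hch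
  have hlog := Real.log_le_log (by positivity) ((div_pow_le_choose hk1 hkn).trans hch)
  rw [Real.log_pow, Real.log_pow, Real.log_mul (Real.exp_pos 1).ne' hn0.ne', Real.log_exp,
    Real.log_div hn0.ne' (by positivity), Real.log_mul two_ne_zero hk0.ne'] at hlog
  have hlogk : Real.log k ≤ α * Real.log n := by
    rw [← Real.log_rpow hn0]
    exact Real.log_le_log hk0 hkle
  have hlogn : 0 ≤ Real.log n := Real.log_nonneg (by linarith)
  refine le_of_mul_le_mul_right ?_ (by linarith : 0 < 1 + Real.log n)
  calc (1 - α - ε) * (n : ℝ) ^ α * (1 + Real.log n)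
      ≤ ((n : ℝ) ^ α - 1) * ((1 - α) * Real.log n - Real.log 2) := hbound
    _ ≤ k * ((1 - α) * Real.log n - Real.log 2) := mul_le_mul_of_nonneg_right hkge hpos
    _ ≤ k * (Real.log n - (Real.log 2 + Real.log k)) :=
        mul_le_mul_of_nonneg_left (by linarith) hk0.le
    _ ≤ d * (1 + Real.log n) := hlog
end

section
/- Let m ≥ 1 and ℓ ≥ 1 be integers, let n = 2^(m−1) · m · ℓ, and let k be an integer with ℓ < k ≤ n. Then ldim(Q(n; ℓ, k)) ≤ 2^(m−1) · ℓ + 2 = n/m + 2. -/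
open scoped Classical

namespace PaperLD

open Finset

theorem sublist_pair_append {α : Type*} {l₁ l₂ : List α} {x y : α} (hx : x ∈ l₁) (hy : y ∈ l₂) :
    [x, y].Sublist (l₁ ++ l₂) :=
  (List.singleton_sublist.2 hx).append (List.singleton_sublist.2 hy)

theorem sublist_pair_or_reverse {α : Type*} {l : List α} {x y : α} (hx : x ∈ l) (hy : y ∈ l)
    (hxy : x ≠ y) :
    [x, y].Sublist l ∨ [x, y].Sublist l.reverse := by
  obtain ⟨s, t, rfl⟩ := List.append_of_mem hx
  rcases List.mem_append.1 hy with hy | hy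
  · right
    rw [List.reverse_append]
    exact sublist_pair_append (by simp) (by simpa using hy)
  · left
    have hy : y ∈ t := (List.mem_cons.1 hy).resolve_left hxy.symm
    exact ((List.singleton_sublist.2 hy).cons_cons x).trans (List.sublist_append_right _ _)

section General

variable {α : Type*} [PartialOrder α]

/-- A list in which no entry lies above a later one is a partial linear extension. -/
def PLE.ofPairwise (l : List α) (h : l.Pairwise fun a b => ¬ b ≤ a) : PLE α where
  toList := l
  nodup := h.imp fun hab hEq => hab hEq.ge
  le_imp i j hij := by
    by_contra hlt
    exact List.pairwise_iff_get.1 h j i (not_le.1 hlt) hij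

theorem PLE.before_of_sublist {L : PLE α} {x y : α} (h : [x, y].Sublist L.toList) :
    L.Before x y := by
  obtain ⟨f, hf⟩ := List.sublist_iff_exists_fin_orderEmbedding_get_eq.1 h
  exact ⟨f 0, f 1, f.monotone (Fin.zero_le _), (hf 0).symm, (hf 1).symm⟩

theorem pairwise_not_ge_append {l₁ l₂ : List α} (h₁ : l₁.Nodup) (h₂ : l₂.Nodup)
    (a₁ : IsAntichain (· ≤ ·) {x | x ∈ l₁}) (a₂ : IsAntichain (· ≤ ·) {x | x ∈ l₂})
    (h : ∀ x ∈ l₁, ∀ y ∈ l₂, ¬ y ≤ x) :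
    (l₁ ++ l₂).Pairwise fun a b => ¬ b ≤ a := by
  refine List.pairwise_append.2 ⟨?_, ?_, h⟩
  · exact List.Pairwise.imp_of_mem (fun ha hb hab => a₁ hb ha hab.symm) h₁
  · exact List.Pairwise.imp_of_mem (fun ha hb hab => a₂ hb ha hab.symm) h₂

theorem ldim_le_of_isLocalRealiser [Fintype α] {ι : Type*} [Fintype ι] {d : ℕ} (F : ι → PLE α)
    (hF : IsLocalRealiser F) (hd : ∀ x, #{i | x ∈ (F i).toList} ≤ d) : ldim α ≤ d := by
  refine Nat.sInf_le ⟨Fintype.card ι, F ∘ (Fintype.equivFin ι).symm, fun x y h => ?_, fun x => ?_⟩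
  · obtain ⟨i, hi⟩ := hF x y h
    exact ⟨Fintype.equivFin ι i, by simpa using hi⟩
  · refine le_trans (le_of_eq ?_) (hd x)
    exact Finset.card_equiv (Fintype.equivFin ι).symm (by simp)

end General

theorem card_filter_not_subset_le {β : Type*} [Fintype β] (T : Finset β) :
    #{S : Finset β | ¬ T ⊆ S} ≤ #T * 2 ^ (Fintype.card β - 1) := by
  have hsub : ({S : Finset β | ¬ T ⊆ S} : Finset (Finset β)) ⊆
      T.biUnion fun c => (univ.erase c).powerset := by
    intro S hS
    obtain ⟨c, hcT, hcS⟩ := Finset.not_subset.1 (mem_filter.1 hS).2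
    refine mem_biUnion.2 ⟨c, hcT, mem_powerset.2 fun a ha => ?_⟩
    exact mem_erase.2 ⟨fun h => hcS (h ▸ ha), mem_univ a⟩
  refine (card_le_card hsub).trans (card_biUnion_le_card_mul _ _ _ fun c _ => ?_)
  rw [card_powerset, card_erase_of_mem (mem_univ c), card_univ]

theorem card_filter_sum_le {A B : Type*} [Fintype A] [Fintype B] (p : A ⊕ B → Prop)
    [DecidablePred p] [DecidablePred fun b => p (Sum.inr b)] {d : ℕ}
    (h : #{b | p (Sum.inr b)} ≤ d) : #{i | p i} ≤ d + Fintype.card A := by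
  rw [card_filter, Fintype.sum_sum_type, add_comm]
  refine add_le_add (le_of_eq_of_le ?_ h) ?_
  · rw [card_filter]
    congr!
  · rw [← card_filter]
    exact card_le_univ _

section Trace

variable {γ β σ : Type*} [Fintype β]

/-- The part of `s` in the block indexed by `j`, when `e` splits the ground set into blocks. -/
noncomputable def trace (e : σ ≃ γ × β) (s : Finset σ) (j : γ) : Finset β :=
  {c | e.symm (j, c) ∈ s}

theorem mem_trace {e : σ ≃ γ × β} {s : Finset σ} {j : γ} {c : β} :
    c ∈ trace e s j ↔ e.symm (j, c) ∈ s := by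
  simp [trace]

theorem trace_mono (e : σ ≃ γ × β) {s t : Finset σ} (h : s ⊆ t) (j : γ) :
    trace e s j ⊆ trace e t j :=
  fun _ hc => mem_trace.2 (h (mem_trace.1 hc))

theorem exists_not_trace_subset (e : σ ≃ γ × β) {s t : Finset σ} (h : ¬ s ⊆ t) :
    ∃ j, ¬ trace e s j ⊆ trace e t j := by
  obtain ⟨a, has, hat⟩ := Finset.not_subset.1 h
  refine ⟨(e a).1, fun hsub => hat ?_⟩
  simpa [mem_trace] using @hsub (e a).2 (mem_trace.2 (by simpa using has))

theorem sum_card_trace [Fintype γ] (e : σ ≃ γ × β) (s : Finset σ) : ∑ j, #(trace e s j) = #s := by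
  rw [← card_sigma]
  exact card_equiv ((Equiv.sigmaEquivProd γ β).trans e.symm) (by simp [mem_trace])

end Trace

section Layers

variable {n ℓ k t m : ℕ}

/-- The sets of cardinality `c` in a pair of layers. -/
noncomputable def layer (n ℓ k c : ℕ) : Finset (BoolLayers n ℓ k) := {s | #s.1 = c}

theorem isAntichain_card_eq {c : ℕ} {U : Set (BoolLayers n ℓ k)} (h : ∀ s ∈ U, #s.1 = c) :
    IsAntichain (· ≤ ·) U := fun s hs t ht hst hle =>
  hst (Subtype.ext (eq_of_subset_of_card_le hle (by rw [h s hs, h t ht])))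

/-- Two linear extensions listing the lower layer before the upper layer, with opposite
orders inside each layer. -/
noncomputable def layerPLE (hℓk : ℓ < k) (b : Bool) : PLE (BoolLayers n ℓ k) :=
  let r : List (BoolLayers n ℓ k) → List (BoolLayers n ℓ k) := fun l => bif b then l else l.reverse
  PLE.ofPairwise (r (layer n ℓ k ℓ).toList ++ r (layer n ℓ k k).toList) <| by
    have hmem : ∀ c s, s ∈ r (layer n ℓ k c).toList ↔ #s.1 = c := by
      intro c s; cases b <;> simp [r, layer]
    have hnodup : ∀ c, (r (layer n ℓ k c).toList).Nodup := by
      intro c; cases b <;> simp [r, nodup_toList]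
    refine pairwise_not_ge_append (hnodup ℓ) (hnodup k)
      (isAntichain_card_eq fun s => (hmem ℓ s).1) (isAntichain_card_eq fun s => (hmem k s).1)
      fun s hs t ht hle => ?_
    have := card_le_card (show t.1 ⊆ s.1 from hle)
    rw [(hmem _ _).1 hs, (hmem _ _).1 ht] at this
    omega

/-- The upper sets with trace `S` on block `j`, followed by the lower sets whose trace on
block `j` is not contained in `S`. -/
noncomputable def blockPLE (e : Fin n ≃ Fin t × Fin m) (j : Fin t)
    (S : Finset (Fin m)) : PLE (BoolLayers n ℓ k) :=
  PLE.ofPairwise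
    (({s ∈ layer n ℓ k k | trace e s.1 j = S} : Finset _).toList ++
      ({s ∈ layer n ℓ k ℓ | ¬ trace e s.1 j ⊆ S} : Finset _).toList) <| by
    refine pairwise_not_ge_append (nodup_toList _) (nodup_toList _)
      (isAntichain_card_eq (c := k) fun s hs => ?_) (isAntichain_card_eq (c := ℓ) fun s hs => ?_)
      fun s hs t ht hle => ?_
    · simp only [Set.mem_ofPred_eq, mem_toList, mem_filter, layer] at hs
      exact hs.1.2
    · simp only [Set.mem_ofPred_eq, mem_toList, mem_filter, layer] at hs
      exact hs.1.2
    · rw [mem_toList, mem_filter] at hs ht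
      exact ht.2 (hs.2 ▸ trace_mono e hle j)

theorem mem_blockPLE {e : Fin n ≃ Fin t × Fin m} {j : Fin t} {S : Finset (Fin m)}
    {s : BoolLayers n ℓ k} :
    s ∈ (blockPLE e j S).toList ↔
      (#s.1 = k ∧ trace e s.1 j = S) ∨ (#s.1 = ℓ ∧ ¬ trace e s.1 j ⊆ S) := by
  simp [blockPLE, PLE.ofPairwise, layer]

/-- The local realiser made of the two layer lists and all block lists. -/
noncomputable def layersFamily (hℓk : ℓ < k) (e : Fin n ≃ Fin t × Fin m) :
    Bool ⊕ Fin t × Finset (Fin m) → PLE (BoolLayers n ℓ k) :=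
  Sum.elim (layerPLE hℓk) fun p => blockPLE e p.1 p.2

theorem exists_layerPLE_before (hℓk : ℓ < k) {c : ℕ} (hc : c = ℓ ∨ c = k)
    {x y : BoolLayers n ℓ k} (hx : #x.1 = c) (hy : #y.1 = c) (hxy : x ≠ y) :
    ∃ b, (layerPLE hℓk b).Before x y := by
  have hmem : ∀ z : BoolLayers n ℓ k, #z.1 = c → z ∈ (layer n ℓ k c).toList := by
    intro z hz; simp [layer, hz]
  rcases sublist_pair_or_reverse (hmem x hx) (hmem y hy) hxy with h | h
  · refine ⟨true, PLE.before_of_sublist (h.trans ?_)⟩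
    rcases hc with rfl | rfl
    · exact List.sublist_append_left _ _
    · exact List.sublist_append_right _ _
  · refine ⟨false, PLE.before_of_sublist (h.trans ?_)⟩
    rcases hc with rfl | rfl
    · exact List.sublist_append_left _ _
    · exact List.sublist_append_right _ _

theorem isLocalRealiser_layersFamily (hℓk : ℓ < k) (e : Fin n ≃ Fin t × Fin m) :
    IsLocalRealiser (layersFamily hℓk e) := by
  intro x y hyx
  have hne : x ≠ y := fun h => hyx h.ge
  rcases x.2 with hx | hx <;> rcases y.2 with hy | hy
  · obtain ⟨b, hb⟩ := exists_layerPLE_before hℓk (Or.inl rfl) hx hy hne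
    exact ⟨Sum.inl b, hb⟩
  · exact ⟨Sum.inl true, PLE.before_of_sublist
      (sublist_pair_append (by simp [layer, hx]) (by simp [layer, hy]))⟩
  · obtain ⟨j, hj⟩ := exists_not_trace_subset e (show ¬ y.1 ⊆ x.1 from hyx)
    exact ⟨Sum.inr (j, trace e x.1 j), PLE.before_of_sublist
      (sublist_pair_append (by simp [layer, hx]) (by simp [layer, hy, hj]))⟩
  · obtain ⟨b, hb⟩ := exists_layerPLE_before hℓk (Or.inr rfl) hx hy hne
    exact ⟨Sum.inl b, hb⟩

theorem card_blockPLE_le (hℓk : ℓ < k) (e : Fin n ≃ Fin t × Fin m) (x : BoolLayers n ℓ k) :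
    #{p : Fin t × Finset (Fin m) | x ∈ (blockPLE e p.1 p.2).toList} ≤
      max t (2 ^ (m - 1) * ℓ) := by
  have hsum : #{p : Fin t × Finset (Fin m) | x ∈ (blockPLE e p.1 p.2).toList} =
      ∑ j, #{S : Finset (Fin m) | x ∈ (blockPLE e j S).toList} := by
    rw [← card_sigma]
    exact (card_equiv (Equiv.sigmaEquivProd _ _) (by simp)).symm
  rw [hsum]
  rcases x.2 with hx | hx
  · refine le_max_of_le_right ?_
    calc ∑ j, #{S : Finset (Fin m) | x ∈ (blockPLE e j S).toList}
        ≤ ∑ j, #(trace e x.1 j) * 2 ^ (m - 1) := by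
          refine sum_le_sum fun j _ => ?_
          refine (card_le_card fun S hS => ?_).trans
            ((card_filter_not_subset_le (trace e x.1 j)).trans_eq (by simp))
          simpa [mem_blockPLE, hx, hℓk.ne] using hS
      _ = 2 ^ (m - 1) * ℓ := by rw [← sum_mul, sum_card_trace, hx, mul_comm]
  · refine le_max_of_le_left ?_
    simp [mem_blockPLE, hx, hℓk.ne', filter_eq]

theorem ldim_boolLayers_le (hℓk : ℓ < k) (e : Fin n ≃ Fin t × Fin m) :
    ldim (BoolLayers n ℓ k) ≤ max t (2 ^ (m - 1) * ℓ) + 2 := by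
  refine ldim_le_of_isLocalRealiser (layersFamily hℓk e) (isLocalRealiser_layersFamily hℓk e)
    fun x => ?_
  convert card_filter_sum_le (A := Bool) (fun i => x ∈ (layersFamily hℓk e i).toList)
    (card_blockPLE_le hℓk e x)
  exact Fintype.card_bool.symm

end Layers

end PaperLD

open PaperLD

/-- For integers `m, ℓ ≥ 1`, if `n = 2^(m−1)·m·ℓ` and `ℓ < k ≤ n`, then
`ldim(Q(n; ℓ, k)) ≤ 2^(m−1)·ℓ + 2 = n/m + 2`. -/
theorem stmt19 (m ℓ n k : ℕ) (hm : 1 ≤ m) (hℓ : 1 ≤ ℓ)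
    (hn : n = 2 ^ (m - 1) * m * ℓ) (hℓk : ℓ < k) (hk : k ≤ n) :
    ldim (BoolLayers n ℓ k) ≤ 2 ^ (m - 1) * ℓ + 2 ∧
      2 ^ (m - 1) * ℓ + 2 = n / m + 2 := by
  have hdiv : n = 2 ^ (m - 1) * ℓ * m := by rw [hn]; ring
  refine ⟨?_, by rw [hdiv, Nat.mul_div_cancel _ hm]⟩
  simpa using ldim_boolLayers_le hℓk ((finCongr hdiv).trans finProdFinEquiv.symm)
end
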